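/- Let W be a random variable with E[W] = 0, E[W²] = 2b² ∈ (0,∞) and E[|W|³] < ∞, let W^L (defined on the same probability space) have the centered equilibrium distribution with respect to W, and let Z ~ Laplace(0,b). Then d_W(W, Z) ≤ 2·E|W − W^L|. -/

import Mathlib

open MeasureTheory ProbabilityTheory Real Set

/-- The Laplace(0,b) distribution on ℝ, with density (1/(2b))·exp(−|x|/b). -/
noncomputable def laplaceDist (b : ℝ) : Measure ℝ :=
  (volume : Measure ℝ).withDensity fun x => ENNReal.ofReal (Real.exp (-|x| / b) / (2 * b))

/-- Kolmogorov distance between two laws on ℝ. -/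
noncomputable def kolDist (μ ν : Measure ℝ) : ℝ :=
  ⨆ z : ℝ, |(μ (Iic z)).toReal - (ν (Iic z)).toReal|

/-- Wasserstein distance between two laws on ℝ: sup over 1-Lipschitz test functions. -/
noncomputable def wassDist (μ ν : Measure ℝ) : ℝ :=
  ⨆ h : {h : ℝ → ℝ // LipschitzWith 1 h}, |(∫ x, h.1 x ∂μ) - ∫ x, h.1 x ∂ν|

/-- d₂ distance: sup over differentiable h with 1-Lipschitz derivative. -/
noncomputable def d2Dist (μ ν : Measure ℝ) : ℝ :=
  ⨆ h : {h : ℝ → ℝ // Differentiable ℝ h ∧ LipschitzWith 1 (deriv h)},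
    |(∫ x, h.1 x ∂μ) - ∫ x, h.1 x ∂ν|

/-- d₁,₂ distance: sup over differentiable h with ‖h'‖∞ ≤ 1 and 1-Lipschitz derivative. -/
noncomputable def d12Dist (μ ν : Measure ℝ) : ℝ :=
  ⨆ h : {h : ℝ → ℝ //
      Differentiable ℝ h ∧ (∀ x, |deriv h x| ≤ 1) ∧ LipschitzWith 1 (deriv h)},
    |(∫ x, h.1 x ∂μ) - ∫ x, h.1 x ∂ν|

/-- The Beta(1,m) distribution on ℝ, with density m(1−x)^{m−1} on (0,1). -/
noncomputable def betaOneDist (m : ℕ) : Measure ℝ :=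
  (volume : Measure ℝ).withDensity fun x =>
    ENNReal.ofReal (if 0 < x ∧ x < 1 then m * (1 - x) ^ (m - 1) else 0)

/-- `WL` has the centered equilibrium distribution with respect to `W`:
`E[f(W)] − f(0) = (1/2)·E[W²]·E[f''(WL)]` for all twice differentiable `f` such that
`E|f(W)| < ∞` and `E|W f'(W)| < ∞` (and `f''(WL)` is integrable). -/
def IsCenteredEquilibrium {Ω : Type*} [MeasureSpace Ω] (W WL : Ω → ℝ) : Prop :=
  ∀ f : ℝ → ℝ, Differentiable ℝ f → Differentiable ℝ (deriv f) →
    Integrable (fun ω => f (W ω)) → Integrable (fun ω => W ω * deriv f (W ω)) →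
    Integrable (fun ω => deriv (deriv f) (WL ω)) →
    (∫ ω, f (W ω)) - f 0 = (1 / 2) * (∫ ω, (W ω) ^ 2) * ∫ ω, deriv (deriv f) (WL ω)

lemma integrable_exp_neg_abs_div {c : ℝ} (hc : 0 < c) :
    Integrable fun x : ℝ => exp (-|x| / c) := by
  have h₁ : IntegrableOn (fun x : ℝ => exp (-|x| / c)) (Iic 0) := by
    refine (integrableOn_exp_mul_Iic (inv_pos.2 hc) 0).congr_fun (fun x hx => ?_) measurableSet_Iic
    simp only [abs_of_nonpos (mem_Iic.1 hx), neg_neg, div_eq_inv_mul]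
  have h₂ : IntegrableOn (fun x : ℝ => exp (-|x| / c)) (Ioi 0) := by
    refine (integrableOn_exp_mul_Ioi (neg_lt_zero.2 (inv_pos.2 hc)) 0).congr_fun
      (fun x hx => ?_) measurableSet_Ioi
    simp only [abs_of_pos (mem_Ioi.1 hx), div_eq_inv_mul, neg_mul, mul_neg]
  have h := h₁.union h₂
  rwa [Iic_union_Ioi, integrableOn_univ] at h

lemma integral_exp_neg_abs_div {b : ℝ} (hb : 0 < b) :
    ∫ x : ℝ, exp (-|x| / b) = 2 * b := by
  rw [integral_comp_abs (f := fun x => exp (-x / b))]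
  have h := integral_exp_mul_Ioi (neg_lt_zero.2 (inv_pos.2 hb)) 0
  have e : (fun x : ℝ => exp (-x / b)) = fun x => exp (-b⁻¹ * x) := by
    funext x; congr 1; rw [div_eq_inv_mul]; ring
  rw [e, h]
  simp

lemma measurable_laplaceDensity (b : ℝ) :
    Measurable fun x : ℝ => ENNReal.ofReal (exp (-|x| / b) / (2 * b)) := by
  fun_prop

lemma integrable_laplaceDist_iff {b : ℝ} (hb : 0 < b) {g : ℝ → ℝ} :
    Integrable g (laplaceDist b) ↔
      Integrable fun x => exp (-|x| / b) / (2 * b) * g x := by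
  rw [laplaceDist, integrable_withDensity_iff_integrable_smul' (measurable_laplaceDensity b)
    (ae_of_all _ fun _ => ENNReal.ofReal_lt_top)]
  refine integrable_congr (ae_of_all _ fun x => ?_)
  simp only [smul_eq_mul]
  rw [ENNReal.toReal_ofReal (by positivity)]

lemma integral_laplaceDist {b : ℝ} (hb : 0 < b) (g : ℝ → ℝ) :
    ∫ x, g x ∂laplaceDist b = ∫ x, exp (-|x| / b) / (2 * b) * g x := by
  rw [laplaceDist, integral_withDensity_eq_integral_toReal_smul (measurable_laplaceDensity b)
    (ae_of_all _ fun _ => ENNReal.ofReal_lt_top)]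
  refine integral_congr_ae (ae_of_all _ fun x => ?_)
  simp only [smul_eq_mul]
  rw [ENNReal.toReal_ofReal (by positivity)]

lemma isProbabilityMeasure_laplaceDist {b : ℝ} (hb : 0 < b) :
    IsProbabilityMeasure (laplaceDist b) := by
  refine ⟨?_⟩
  rw [laplaceDist, withDensity_apply _ MeasurableSet.univ, Measure.restrict_univ,
    ← ofReal_integral_eq_lintegral_ofReal ((integrable_exp_neg_abs_div hb).div_const _)
      (ae_of_all _ fun x => by positivity), integral_div, integral_exp_neg_abs_div hb,
    div_self (by positivity), ENNReal.ofReal_one]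

lemma integrable_id_laplaceDist {b : ℝ} (hb : 0 < b) :
    Integrable (fun x : ℝ => x) (laplaceDist b) := by
  rw [integrable_laplaceDist_iff hb]
  refine (integrable_exp_neg_abs_div (c := 2 * b) (by positivity)).mono'
    (by fun_prop) (ae_of_all _ fun x => ?_)
  have h₁ : |x| / (2 * b) ≤ exp (|x| / (2 * b)) := by
    linarith [add_one_le_exp (|x| / (2 * b))]
  have h₂ : exp (-|x| / b) * exp (|x| / (2 * b)) = exp (-|x| / (2 * b)) := by
    rw [← exp_add]; congr 1; field_simp; ring
  rw [norm_mul, norm_eq_abs, norm_eq_abs, abs_of_pos (by positivity : 0 < exp (-|x| / b) / (2 * b)),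
    ← h₂]
  calc exp (-|x| / b) / (2 * b) * |x| = exp (-|x| / b) * (|x| / (2 * b)) := by ring
    _ ≤ _ := by gcongr

lemma LipschitzWith.integrable_comp_of_integrable {α : Type*} {m : MeasurableSpace α}
    {μ : Measure α} [IsFiniteMeasure μ] {X : α → ℝ} (hX : Integrable X μ)
    {K : NNReal} {g : ℝ → ℝ} (hg : LipschitzWith K g) : Integrable (fun a => g (X a)) μ := by
  refine ((hX.abs.const_mul (K : ℝ)).add (integrable_const |g 0|)).mono'
    (hg.continuous.comp_aestronglyMeasurable hX.1) (ae_of_all _ fun a => ?_)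
  have h := hg.dist_le_mul (X a) 0
  rw [dist_eq, dist_eq, sub_zero] at h
  have := abs_add_le (g (X a) - g 0) (g 0)
  rw [sub_add_cancel] at this
  simp only [Pi.add_apply, norm_eq_abs]
  linarith

/-- Convolution of `h` with the Laplace distribution: the solution of the Stein equation
`G - b ^ 2 * G'' = h`. -/
noncomputable def laplaceConv (b : ℝ) (h : ℝ → ℝ) (x : ℝ) : ℝ :=
  ∫ z, h (x + z) ∂laplaceDist b

lemma integrable_comp_add_laplaceDist {b : ℝ} (hb : 0 < b) {K : NNReal} {h : ℝ → ℝ}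
    (hh : LipschitzWith K h) (x : ℝ) : Integrable (fun z => h (x + z)) (laplaceDist b) := by
  have := isProbabilityMeasure_laplaceDist hb
  exact hh.integrable_comp_of_integrable ((integrable_const x).add (integrable_id_laplaceDist hb))

lemma lipschitzWith_laplaceConv {b : ℝ} (hb : 0 < b) {K : NNReal} {h : ℝ → ℝ}
    (hh : LipschitzWith K h) : LipschitzWith K (laplaceConv b h) := by
  have := isProbabilityMeasure_laplaceDist hb
  refine LipschitzWith.of_dist_le_mul fun x y => ?_
  rw [dist_eq, laplaceConv, laplaceConv,
    ← integral_sub (integrable_comp_add_laplaceDist hb hh x)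
      (integrable_comp_add_laplaceDist hb hh y), ← norm_eq_abs]
  refine (norm_integral_le_of_norm_le_const (C := K * dist x y) (ae_of_all _ fun z => ?_)).trans
    (by simp)
  simpa [dist_eq] using hh.dist_le_mul (x + z) (y + z)

lemma integrable_laplace_kernel_mul {b : ℝ} (hb : 0 < b) {K : NNReal} {h : ℝ → ℝ}
    (hh : LipschitzWith K h) (x : ℝ) :
    Integrable fun y => exp (-|y - x| / b) / (2 * b) * h y := by
  have := ((integrable_laplaceDist_iff hb).1
    (integrable_comp_add_laplaceDist hb hh x)).comp_sub_right x
  simpa using this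

lemma laplaceConv_eq_integral_kernel {b : ℝ} (hb : 0 < b) (h : ℝ → ℝ) (x : ℝ) :
    laplaceConv b h x = ∫ y, exp (-|y - x| / b) / (2 * b) * h y := by
  rw [laplaceConv, integral_laplaceDist hb,
    ← integral_sub_right_eq_self (fun z => exp (-|z| / b) / (2 * b) * h (x + z)) x]
  simp

lemma integrableOn_Iic_exp_mul {b : ℝ} (hb : 0 < b) {K : NNReal} {h : ℝ → ℝ}
    (hh : LipschitzWith K h) (x : ℝ) : IntegrableOn (fun y => exp (y / b) * h y) (Iic x) := by
  refine IntegrableOn.congr_fun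
    ((integrable_laplace_kernel_mul hb hh x).const_mul (2 * b * exp (x / b))).integrableOn
    (fun y hy => ?_) measurableSet_Iic
  have e : exp (y / b) = exp (x / b) * exp (-|y - x| / b) := by
    rw [← exp_add, abs_of_nonpos (sub_nonpos.2 hy)]; congr 1; ring
  simp only [e]
  field_simp

lemma integrableOn_Ioi_exp_mul {b : ℝ} (hb : 0 < b) {K : NNReal} {h : ℝ → ℝ}
    (hh : LipschitzWith K h) (x : ℝ) : IntegrableOn (fun y => exp (-y / b) * h y) (Ioi x) := by
  refine IntegrableOn.congr_fun
    ((integrable_laplace_kernel_mul hb hh x).const_mul (2 * b * exp (-x / b))).integrableOn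
    (fun y hy => ?_) measurableSet_Ioi
  have e : exp (-y / b) = exp (-x / b) * exp (-|y - x| / b) := by
    rw [← exp_add, abs_of_pos (sub_pos.2 hy)]; congr 1; ring
  simp only [e]
  field_simp

lemma laplaceConv_eq_add {b : ℝ} (hb : 0 < b) {K : NNReal} {h : ℝ → ℝ}
    (hh : LipschitzWith K h) (x : ℝ) :
    laplaceConv b h x =
      (exp (-x / b) * (∫ y in Iic x, exp (y / b) * h y)
        + exp (x / b) * ∫ y in Ioi x, exp (-y / b) * h y) / (2 * b) := by
  have hi := integrable_laplace_kernel_mul hb hh x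
  rw [laplaceConv_eq_integral_kernel hb,
    ← intervalIntegral.integral_Iic_add_Ioi (b := x) hi.integrableOn hi.integrableOn, add_div]
  congr 1
  · rw [← integral_const_mul, ← integral_div]
    refine setIntegral_congr_fun measurableSet_Iic fun y hy => ?_
    have e : exp (-|y - x| / b) = exp (-x / b) * exp (y / b) := by
      rw [← exp_add, abs_of_nonpos (sub_nonpos.2 hy)]; congr 1; ring
    simp only [e]
    ring
  · rw [← integral_const_mul, ← integral_div]
    refine setIntegral_congr_fun measurableSet_Ioi fun y hy => ?_
    have e : exp (-|y - x| / b) = exp (x / b) * exp (-y / b) := by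
      rw [← exp_add, abs_of_pos (sub_pos.2 hy)]; congr 1; ring
    simp only [e]
    ring

lemma hasDerivAt_integral_Iic {f : ℝ → ℝ} (hf : Continuous f)
    (hi : ∀ x, IntegrableOn f (Iic x)) (x : ℝ) :
    HasDerivAt (fun x => ∫ y in Iic x, f y) (f x) x := by
  have e : (fun x => ∫ y in Iic x, f y) =
      fun x => (∫ y in (0 : ℝ)..x, f y) + ∫ y in Iic 0, f y := by
    funext x
    rw [← intervalIntegral.integral_Iic_sub_Iic (hi 0) (hi x), sub_add_cancel]
  rw [e]
  exact (hf.integral_hasStrictDerivAt 0 x).hasDerivAt.add_const _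

lemma hasDerivAt_integral_Ioi {f : ℝ → ℝ} (hf : Continuous f)
    (hi : ∀ x, IntegrableOn f (Ioi x)) (x : ℝ) :
    HasDerivAt (fun x => ∫ y in Ioi x, f y) (-f x) x := by
  have e : (fun x => ∫ y in Ioi x, f y) =
      fun x => (∫ y in Ioi 0, f y) - ∫ y in (0 : ℝ)..x, f y := by
    funext x
    rw [← intervalIntegral.integral_Ioi_sub_Ioi' (hi 0) (hi x), sub_sub_cancel]
  rw [e]
  exact (hf.integral_hasStrictDerivAt 0 x).hasDerivAt.const_sub _

lemma laplaceConv_hasDerivAt {b : ℝ} (hb : 0 < b) {K : NNReal} {h : ℝ → ℝ}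
    (hh : LipschitzWith K h) :
    ∃ g : ℝ → ℝ, ∀ x, HasDerivAt (laplaceConv b h) (g x) x ∧
      HasDerivAt g ((laplaceConv b h x - h x) / b ^ 2) x := by
  set A : ℝ → ℝ := fun x => ∫ y in Iic x, exp (y / b) * h y
  set B : ℝ → ℝ := fun x => ∫ y in Ioi x, exp (-y / b) * h y
  have hc := hh.continuous
  have hA (x : ℝ) : HasDerivAt A (exp (x / b) * h x) x :=
    hasDerivAt_integral_Iic (f := fun y => exp (y / b) * h y) (by fun_prop)
      (integrableOn_Iic_exp_mul hb hh) x
  have hB (x : ℝ) : HasDerivAt B (-(exp (-x / b) * h x)) x :=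
    hasDerivAt_integral_Ioi (f := fun y => exp (-y / b) * h y) (by fun_prop)
      (integrableOn_Ioi_exp_mul hb hh) x
  have hp (x : ℝ) : HasDerivAt (fun x => exp (x / b)) (exp (x / b) / b) x := by
    simpa [div_eq_mul_inv] using ((hasDerivAt_id x).div_const b).exp
  have hn (x : ℝ) : HasDerivAt (fun x => exp (-x / b)) (-(exp (-x / b) / b)) x := by
    simpa [div_eq_mul_inv] using ((hasDerivAt_id x).neg.div_const b).exp
  have hmul (x : ℝ) : exp (-x / b) * exp (x / b) = 1 := by
    rw [← exp_add, neg_div, neg_add_cancel, exp_zero]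
  have hG : laplaceConv b h =
      fun x => (exp (-x / b) * A x + exp (x / b) * B x) / (2 * b) :=
    funext fun x => laplaceConv_eq_add hb hh x
  refine ⟨fun x => (exp (x / b) * B x - exp (-x / b) * A x) / (2 * b ^ 2), fun x => ⟨?_, ?_⟩⟩
  · rw [hG]
    refine ((((hn x).mul (hA x)).add ((hp x).mul (hB x))).div_const (2 * b)).congr_deriv ?_
    field_simp
    ring
  · rw [hG]
    refine ((((hp x).mul (hB x)).sub ((hn x).mul (hA x))).div_const (2 * b ^ 2)).congr_deriv ?_
    have := hmul x
    rw [neg_div] at this ⊢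
    field_simp
    linear_combination (-2 * b * h x) * this

lemma abs_integral_interval_le_of_abs_le {φ : ℝ → ℝ} {C x : ℝ}
    (h : ∀ y, |y| ≤ |x| → |φ y| ≤ C) : |∫ y in (0 : ℝ)..x, φ y| ≤ C * |x| := by
  have := intervalIntegral.norm_integral_le_of_norm_le_const (a := 0) (b := x) (f := φ) (C := C)
    fun y hy => h y ?_
  · simpa using this
  · rcases le_total 0 x with h0 | h0
    · rw [uIoc_of_le h0] at hy
      rw [abs_of_pos hy.1, abs_of_nonneg h0]; exact hy.2
    · rw [uIoc_of_ge h0] at hy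
      rw [abs_of_nonpos hy.2, abs_of_nonpos h0]; linarith [hy.1]

namespace IsCenteredEquilibrium

variable {Ω : Type*} [MeasureSpace Ω] {W WL : Ω → ℝ}

lemma integral_le_of_le_abs (hCE : IsCenteredEquilibrium W WL) (hW : Measurable W)
    (hW3 : Integrable fun ω => |W ω| ^ 3)
    {φ : ℝ → ℝ} (hφ : Continuous φ) (hφ' : ∀ x, |φ x| ≤ |x|)
    (hi : Integrable fun ω => φ (WL ω)) :
    (1 / 2) * (∫ ω, (W ω) ^ 2) * ∫ ω, φ (WL ω) ≤ ∫ ω, |W ω| ^ 3 := by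
  set F' : ℝ → ℝ := fun x => ∫ y in (0 : ℝ)..x, φ y with hF'
  set F : ℝ → ℝ := fun x => ∫ y in (0 : ℝ)..x, F' y with hF
  have d1 (x : ℝ) : HasDerivAt F' (φ x) x := (hφ.integral_hasStrictDerivAt 0 x).hasDerivAt
  have c1 : Continuous F' := continuous_iff_continuousAt.2 fun x => (d1 x).continuousAt
  have d2 (x : ℝ) : HasDerivAt F (F' x) x := (c1.integral_hasStrictDerivAt 0 x).hasDerivAt
  have c2 : Continuous F := continuous_iff_continuousAt.2 fun x => (d2 x).continuousAt
  have e2 : deriv F = F' := funext fun x => (d2 x).deriv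
  have e1 : deriv F' = φ := funext fun x => (d1 x).deriv
  have b1 (x : ℝ) : |F' x| ≤ |x| * |x| :=
    abs_integral_interval_le_of_abs_le fun y hy => (hφ' y).trans hy
  have b2 (x : ℝ) : |F x| ≤ |x| ^ 3 := by
    have := abs_integral_interval_le_of_abs_le (φ := F') (C := |x| * |x|) (x := x)
      fun y hy => (b1 y).trans (by gcongr)
    calc _ ≤ _ := this
      _ = _ := by ring
  have i1 : Integrable fun ω => F (W ω) :=
    hW3.mono' (c2.measurable.comp hW).aestronglyMeasurable (ae_of_all _ fun ω => b2 _)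
  have i2 : Integrable fun ω => W ω * F' (W ω) := by
    refine hW3.mono' (hW.mul (c1.measurable.comp hW)).aestronglyMeasurable
      (ae_of_all _ fun ω => ?_)
    rw [norm_mul, norm_eq_abs, norm_eq_abs]
    calc _ ≤ |W ω| * (|W ω| * |W ω|) := by gcongr; exact b1 _
      _ = _ := by ring
  have key := hCE F (fun x => (d2 x).differentiableAt)
    (by rw [e2]; exact fun x => (d1 x).differentiableAt) i1 (by rwa [e2]) (by rwa [e2, e1])
  rw [e2, e1] at key
  have F0 : F 0 = 0 := by simp [hF]
  rw [← key, F0, sub_zero]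
  exact integral_mono i1 hW3 fun ω => (le_abs_self _).trans (b2 _)

lemma integrable_of_integrable_abs_pow_three [IsFiniteMeasure (volume : Measure Ω)]
    (hCE : IsCenteredEquilibrium W WL) (hW : Measurable W) (hWL : Measurable WL)
    (hW2 : 0 < ∫ ω, (W ω) ^ 2) (hW3 : Integrable fun ω => |W ω| ^ 3) : Integrable WL := by
  have hi (n : ℕ) : Integrable fun ω => min |WL ω| (n : ℝ) := by
    refine (integrable_const (n : ℝ)).mono' (by fun_prop) (ae_of_all _ fun ω => ?_)
    rw [norm_eq_abs, abs_of_nonneg (by positivity)]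
    exact min_le_right _ _
  have hle (n : ℕ) : ∫ ω, min |WL ω| (n : ℝ) ≤
      (∫ ω, |W ω| ^ 3) / ((1 / 2) * ∫ ω, (W ω) ^ 2) := by
    rw [le_div_iff₀' (by positivity)]
    refine hCE.integral_le_of_le_abs hW hW3 (φ := fun x => min |x| (n : ℝ)) (by fun_prop)
      (fun x => ?_) (hi n)
    rw [abs_of_nonneg (by positivity)]
    exact min_le_left _ _
  have hlim : Filter.Tendsto (fun n : ℕ => ∫⁻ ω, ENNReal.ofReal (min |WL ω| (n : ℝ)))
      Filter.atTop (nhds (∫⁻ ω, ENNReal.ofReal |WL ω|)) := by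
    refine lintegral_tendsto_of_tendsto_of_monotone (fun n => by fun_prop)
      (ae_of_all _ fun ω n m hnm => ?_) (ae_of_all _ fun ω => ?_)
    · dsimp only
      gcongr
    · refine tendsto_const_nhds.congr' ?_
      obtain ⟨N, hN⟩ := exists_nat_ge |WL ω|
      filter_upwards [Filter.eventually_ge_atTop N] with n hn
      rw [min_eq_left (hN.trans (Nat.cast_le.2 hn))]
  have hbound := le_of_tendsto' hlim fun n => by
    rw [← ofReal_integral_eq_lintegral_ofReal (hi n) (ae_of_all _ fun ω => by positivity)]
    exact ENNReal.ofReal_le_ofReal (hle n)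
  refine ⟨hWL.aestronglyMeasurable, ?_⟩
  rw [hasFiniteIntegral_iff_norm]
  exact hbound.trans_lt ENNReal.ofReal_lt_top

end IsCenteredEquilibrium

/-- Theorem 2.4: Laplace approximation bounds via the centered equilibrium distribution. -/
theorem centered_equilibrium_wasserstein_W
    {Ω : Type*} [MeasureSpace Ω] [IsProbabilityMeasure (volume : Measure Ω)]
    (W WL : Ω → ℝ) (hWmeas : Measurable W) (hWLmeas : Measurable WL)
    (b : ℝ) (hb : 0 < b)
    (hWmean : ∫ ω, W ω = 0)
    (hWsqInt : Integrable fun ω => (W ω) ^ 2)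
    (hWvar : ∫ ω, (W ω) ^ 2 = 2 * b ^ 2)
    (hCE : IsCenteredEquilibrium W WL)
    (hW3Int : Integrable fun ω => |W ω| ^ 3) :
    wassDist (Measure.map W volume) (laplaceDist b) ≤ 2 * ∫ ω, |W ω - WL ω| := by
  have hWint : Integrable W := by
    refine (hWsqInt.add (integrable_const (1 : ℝ))).mono' hWmeas.aestronglyMeasurable
      (ae_of_all _ fun ω => ?_)
    simp only [Pi.add_apply, norm_eq_abs]
    nlinarith [sq_abs (W ω), sq_nonneg (|W ω| - 1), abs_nonneg (W ω)]
  have hWLint : Integrable WL := hCE.integrable_of_integrable_abs_pow_three hWmeas hWLmeas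
    (by rw [hWvar]; positivity) hW3Int
  refine Real.iSup_le ?_ (by positivity)
  rintro ⟨h, hh⟩
  obtain ⟨g, hg⟩ := laplaceConv_hasDerivAt hb hh
  set G := laplaceConv b h
  have hGlip : LipschitzWith 1 G := lipschitzWith_laplaceConv hb hh
  have eg : deriv G = g := funext fun x => (hg x).1.deriv
  have eg' : deriv g = fun x => (G x - h x) / b ^ 2 := funext fun x => (hg x).2.deriv
  have hdlip : LipschitzWith 2 fun x => G x - h x := by
    simpa only [one_add_one_eq_two] using hGlip.sub hh
  have hgb (x : ℝ) : |g x| ≤ 1 := by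
    simpa [eg] using norm_deriv_le_of_lipschitz (x₀ := x) hGlip
  have hgd : Differentiable ℝ g := fun x => (hg x).2.differentiableAt
  have iG := hGlip.integrable_comp_of_integrable hWint
  have ih := hh.integrable_comp_of_integrable hWint
  have idL := hdlip.integrable_comp_of_integrable hWLint
  have idW := hdlip.integrable_comp_of_integrable hWint
  have iWg : Integrable fun ω => W ω * g (W ω) := by
    refine hWint.abs.mono' (hWmeas.mul (hgd.continuous.measurable.comp hWmeas)).aestronglyMeasurable
      (ae_of_all _ fun ω => ?_)
    rw [norm_mul, norm_eq_abs, norm_eq_abs]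
    exact mul_le_of_le_one_right (abs_nonneg _) (hgb _)
  have key := hCE G (fun x => (hg x).1.differentiableAt) (by rwa [eg]) iG (by rwa [eg])
    (by rw [eg, eg']; exact idL.div_const _)
  rw [eg, eg', hWvar, integral_div] at key
  have hG0 : G 0 = ∫ x, h x ∂laplaceDist b := by simp [G, laplaceConv]
  have hsub : ∫ ω, (G (W ω) - h (W ω)) = (∫ ω, G (W ω)) - ∫ ω, h (W ω) := integral_sub iG ih
  have hstein : (∫ ω, h (W ω)) - G 0 =
      ∫ ω, ((G (WL ω) - h (WL ω)) - (G (W ω) - h (W ω))) := by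
    rw [integral_sub idL idW, hsub]
    have : 1 / 2 * (2 * b ^ 2) * ((∫ ω, (G (WL ω) - h (WL ω))) / b ^ 2) =
        ∫ ω, (G (WL ω) - h (WL ω)) := by field_simp
    linarith
  dsimp only
  rw [integral_map hWmeas.aemeasurable hh.continuous.aestronglyMeasurable, ← hG0, hstein,
    ← integral_const_mul]
  refine (abs_integral_le_integral_abs).trans
    (integral_mono (idL.sub idW).abs ((hWint.sub hWLint).abs.const_mul 2) fun ω => ?_)
  have := hdlip.dist_le_mul (WL ω) (W ω)
  rw [dist_eq, dist_eq, abs_sub_comm (WL ω)] at this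
  exact this
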